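/- Let S be a convex cone in CB^σ_e(M) satisfying ψ ∘ Ad_V ∈ S for every V ∈ M and ψ ∈ S. For φ ∈ CB^σ_e(M), the following are equivalent: (i) ⟨C_ψ, D_φ⟩ ≥ 0 for every ψ ∈ S; (ii) φ ∘ ψ is completely positive for every ψ ∈ S; (iii) φ̃(C_ψ) is a positive operator for every ψ ∈ S; (iv) ψ̃_*(D_φ) is a positive operator for every ψ ∈ S. -/

import Mathlib

set_option synthInstance.maxHeartbeats 1000000
set_option maxHeartbeats 1000000

noncomputable section

open scoped InnerProductSpace ComplexOrder
open ContinuousLinearMap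

local notation "⟪" x ", " y "⟫" => @inner ℂ _ _ x y

namespace ChoiInf

variable {H : Type*} [NormedAddCommGroup H] [InnerProductSpace ℂ H] [CompleteSpace H]

/-- The rank one operator `x ⊠ y : z ↦ (z|y)·x = ⟪y, z⟫ • x`
(inner products written with Mathlib's convention: conjugate linear in the
first variable, so that the paper's `(z|y)` is `⟪y, z⟫`). -/
def rankOne (x y : H) : H →L[ℂ] H := (innerSL ℂ y).smulRight x

/-- The trace of an operator, computed relative to a Hilbert basis:
`Tr X = Σᵢ (X eᵢ | eᵢ) = Σᵢ ⟪eᵢ, X eᵢ⟫`.  (For trace class operators this does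
not depend on the choice of basis.) -/
def tr {ι : Type*} (b : HilbertBasis ι ℂ H) (T : H →L[ℂ] H) : ℂ :=
  ∑' i, ⟪b i, T (b i)⟫

/-- The bilinear pairing `⟨A, B⟩ = Tr (A B)` between `B(H)` and `T(H)`. -/
def pairing {ι : Type*} (b : HilbertBasis ι ℂ H) (A T : H →L[ℂ] H) : ℂ :=
  tr b (A ∘L T)

/-- Trace class operators, characterized by nuclear representations
`T = Σₙ xₙ ⊠ yₙ` with `Σₙ ‖xₙ‖‖yₙ‖ < ∞`. -/
def IsTraceClass (T : H →L[ℂ] H) : Prop :=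
  ∃ x y : ℕ → H, Summable (fun n => ‖x n‖ * ‖y n‖) ∧
    ∀ z, T z = ∑' n, ⟪y n, z⟫ • x n

/-- The trace norm, as the infimum of `Σₙ ‖xₙ‖‖yₙ‖` over all nuclear
representations `T = Σₙ xₙ ⊠ yₙ`. -/
def traceNorm (T : H →L[ℂ] H) : ℝ :=
  sInf {c : ℝ | ∃ x y : ℕ → H, HasSum (fun n => ‖x n‖ * ‖y n‖) c ∧
    ∀ z, T z = ∑' n, ⟪y n, z⟫ • x n}

/-- `(Φ, Φst)` is a dual pair:  `Φst` preserves the trace class and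
`⟨Φ A, T⟩ = ⟨A, Φst T⟩` for all trace class `T`.  A linear map `Φ` on `B(H)` is
normal (σ-weakly continuous) precisely when it admits such a predual map `Φst`. -/
def IsNormalPair {ι : Type*} (b : HilbertBasis ι ℂ H)
    (Φ Φst : (H →L[ℂ] H) →ₗ[ℂ] (H →L[ℂ] H)) : Prop :=
  (∀ T, IsTraceClass T → IsTraceClass (Φst T)) ∧
    ∀ A T, IsTraceClass T → pairing b (Φ A) T = pairing b A (Φst T)

/-- Positivity of a `k × k` matrix of operators, i.e. positivity of the
corresponding operator on `H ⊕ ⋯ ⊕ H`. -/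
def MatPos {k : ℕ} (A : Fin k → Fin k → (H →L[ℂ] H)) : Prop :=
  ∀ v : Fin k → H, 0 ≤ ∑ i, ∑ j, ⟪v i, A i j (v j)⟫

/-- The operator on `H ⊕ ⋯ ⊕ H` given by a `k × k` matrix of operators has norm `≤ c`. -/
def matNormLe {k : ℕ} (A : Fin k → Fin k → (H →L[ℂ] H)) (c : ℝ) : Prop :=
  ∀ v w : Fin k → H,
    ‖∑ i, ∑ j, ⟪w i, A i j (v j)⟫‖ ≤
      c * Real.sqrt (∑ i, ‖v i‖ ^ 2) * Real.sqrt (∑ i, ‖w i‖ ^ 2)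

/-- A von Neumann algebra is a factor when its center consists of the scalars. -/
def IsFactor (M : VonNeumannAlgebra H) : Prop :=
  ∀ T ∈ M, T ∈ M.commutant → ∃ c : ℂ, T = c • (1 : H →L[ℂ] H)

/-- `x0` is a cyclic vector for `M`. -/
def Cyclic (M : VonNeumannAlgebra H) (x0 : H) : Prop :=
  Dense {y : H | ∃ A ∈ M, A x0 = y}

/-- `x0` is a separating vector for `M`. -/
def Separating (M : VonNeumannAlgebra H) (x0 : H) : Prop :=
  ∀ A ∈ M, A x0 = 0 → A = 0

/-- `Φ` restricts on `alg(M', M)` to the map `φ̃ : A'B ↦ A'·φ(B)`.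
(Maps `φ : M → M` are encoded as linear maps on `B(H)` sending `M` into `M`;
only the restriction to `M` is relevant.) -/
def ExtendsTilde (M : VonNeumannAlgebra H)
    (φ Φ : (H →L[ℂ] H) →ₗ[ℂ] (H →L[ℂ] H)) : Prop :=
  ∀ A' ∈ M.commutant, ∀ B ∈ M, Φ (A' * B) = A' * φ B

/-- The space `CB^σ_ε(M)` of maps `φ : M → M` such that `φ̃` extends to a normal
map on `B(H)`. -/
def CBSigmaE {ι : Type*} (b : HilbertBasis ι ℂ H) (M : VonNeumannAlgebra H) :
    Set ((H →L[ℂ] H) →ₗ[ℂ] (H →L[ℂ] H)) :=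
  {φ | (∀ B ∈ M, φ B ∈ M) ∧
    ∃ Φ Φst, ExtendsTilde M φ Φ ∧ IsNormalPair b Φ Φst}

/-- `φ` is completely positive as a map on `M`. -/
def IsCPOn (M : VonNeumannAlgebra H) (φ : (H →L[ℂ] H) →ₗ[ℂ] (H →L[ℂ] H)) : Prop :=
  ∀ (k : ℕ) (A : Fin k → Fin k → (H →L[ℂ] H)), (∀ i j, A i j ∈ M) →
    MatPos A → MatPos fun i j => φ (A i j)

/-- `φ` is completely positive (on all of `B(H)`). -/
def IsCPFull (φ : (H →L[ℂ] H) →ₗ[ℂ] (H →L[ℂ] H)) : Prop :=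
  ∀ (k : ℕ) (A : Fin k → Fin k → (H →L[ℂ] H)), MatPos A → MatPos fun i j => φ (A i j)

/-- `c` is a completely bounded bound for `φ` as a map on `M`. -/
def CBBoundOn (M : VonNeumannAlgebra H) (φ : (H →L[ℂ] H) →ₗ[ℂ] (H →L[ℂ] H))
    (c : ℝ) : Prop :=
  ∀ (k : ℕ) (A : Fin k → Fin k → (H →L[ℂ] H)), (∀ i j, A i j ∈ M) →
    matNormLe A 1 → matNormLe (fun i j => φ (A i j)) c

/-- The completely bounded norm of `φ` as a map on `M`. -/
def cbNormOn (M : VonNeumannAlgebra H) (φ : (H →L[ℂ] H) →ₗ[ℂ] (H →L[ℂ] H)) : ℝ :=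
  sInf {c : ℝ | 0 ≤ c ∧ CBBoundOn M φ c}

/-- `φ` is completely bounded as a map on `M`. -/
def IsCBOn (M : VonNeumannAlgebra H) (φ : (H →L[ℂ] H) →ₗ[ℂ] (H →L[ℂ] H)) : Prop :=
  ∃ c, 0 ≤ c ∧ CBBoundOn M φ c

/-- `φ` is normal as a map on `M`: every normal functional composed with `φ`
is again normal (i.e. implemented by a trace class operator). -/
def NormalOn {ι : Type*} (b : HilbertBasis ι ℂ H) (M : VonNeumannAlgebra H)
    (φ : (H →L[ℂ] H) →ₗ[ℂ] (H →L[ℂ] H)) : Prop :=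
  ∀ T, IsTraceClass T → ∃ T', IsTraceClass T' ∧
    ∀ A ∈ M, pairing b (φ A) T = pairing b A T'

/-- The map `Ad_V : X ↦ V* X V`. -/
def AdL (V : H →L[ℂ] H) : (H →L[ℂ] H) →ₗ[ℂ] (H →L[ℂ] H) where
  toFun X := star V * X * V
  map_add' X Y := by simp [add_mul, mul_add]
  map_smul' c X := by simp [smul_mul_assoc, mul_smul_comm]

/-- `p` is a minimal (nonzero) projection in `M`. -/
def IsMinimalProjection (M : VonNeumannAlgebra H) (p : H →L[ℂ] H) : Prop :=
  p ∈ M ∧ IsIdempotentElem p ∧ IsSelfAdjoint p ∧ p ≠ 0 ∧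
    ∀ q, q ∈ M → IsIdempotentElem q → IsSelfAdjoint q → q ≠ 0 →
      q * p = q → p * q = q → q = p

/-- A factor is of type I precisely when it contains a minimal projection. -/
def IsTypeI (M : VonNeumannAlgebra H) : Prop :=
  ∃ p, IsMinimalProjection M p




variable {K : Type*} [NormedAddCommGroup K] [InnerProductSpace ℂ K] [CompleteSpace K]

/-- `T` is a Hilbert–Schmidt operator (relative to a Hilbert basis `e`;
this does not depend on the choice of `e`). -/
def IsHS {ι : Type*} (e : HilbertBasis ι ℂ K) (T : K →L[ℂ] K) : Prop :=
  Summable fun i => ‖T (e i)‖ ^ 2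

/-- A model of the Hilbert space `HS(K)` of Hilbert–Schmidt operators on `K`,
with `B(K)` acting by left multiplications `Lmul` and right multiplications
`Rmul`.  `toOp` regards a vector of `H` as an operator on `K`; its range is
exactly the set of Hilbert–Schmidt operators, and the inner product of `H` is
`(x|y) = Tr (x y*)`, i.e. `⟪x, y⟫ = Σᵢ ⟪x eᵢ, y eᵢ⟫`. -/
structure HSModel {ι : Type*} (e : HilbertBasis ι ℂ K) (H : Type*)
    [NormedAddCommGroup H] [InnerProductSpace ℂ H] [CompleteSpace H] where
  toOp : H →ₗ[ℂ] (K →L[ℂ] K)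
  inj : Function.Injective toOp
  mem_range : ∀ T : K →L[ℂ] K, IsHS e T ↔ ∃ x : H, toOp x = T
  inner_eq : ∀ x y : H, ⟪x, y⟫ = ∑' i, ⟪toOp x (e i), toOp y (e i)⟫
  Lmul : (K →L[ℂ] K) → (H →L[ℂ] H)
  Lmul_eq : ∀ a x, toOp (Lmul a x) = a ∘L toOp x
  Rmul : (K →L[ℂ] K) → (H →L[ℂ] H)
  Rmul_eq : ∀ a x, toOp (Rmul a x) = toOp x ∘L a

/-- The operator `T` has rank at most `k`. -/
def rankLE (T : K →L[ℂ] K) (k : ℕ) : Prop :=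
  Module.rank ℂ (LinearMap.range (T : K →ₗ[ℂ] K)) ≤ (k : Cardinal)

variable {H : Type*} [NormedAddCommGroup H] [InnerProductSpace ℂ H] [CompleteSpace H]
  {ι : Type*} {e : HilbertBasis ι ℂ K}

/-- `Φ` restricts to the map `φ̃ : R_y L_x ↦ R_y L_{φ(x)}` on `alg(M', M)` for
`M = L_{B(K)}`. -/
def HSExt (m : HSModel e H) (φ : (K →L[ℂ] K) →ₗ[ℂ] (K →L[ℂ] K))
    (Φ : (H →L[ℂ] H) →ₗ[ℂ] (H →L[ℂ] H)) : Prop :=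
  ∀ a x : K →L[ℂ] K, Φ (m.Rmul a ∘L m.Lmul x) = m.Rmul a ∘L m.Lmul (φ x)

/-- `φ` is `k`-positive. -/
def kPos (k : ℕ) (φ : (K →L[ℂ] K) →ₗ[ℂ] (K →L[ℂ] K)) : Prop :=
  ∀ A : Fin k → Fin k → (K →L[ℂ] K), MatPos A → MatPos fun i j => φ (A i j)

/-- `φ` is completely bounded (as a map on all of `B(K)`). -/
def IsCBFullK (φ : (K →L[ℂ] K) →ₗ[ℂ] (K →L[ℂ] K)) : Prop :=
  ∃ c, 0 ≤ c ∧ ∀ (k : ℕ) (A : Fin k → Fin k → (K →L[ℂ] K)),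
    matNormLe A 1 → matNormLe (fun i j => φ (A i j)) c

/-- `φ` belongs to `CB^σ(B(K))`: it is normal and completely bounded. -/
def NormalCB (e : HilbertBasis ι ℂ K) (φ : (K →L[ℂ] K) →ₗ[ℂ] (K →L[ℂ] K)) : Prop :=
  (∃ φst, IsNormalPair e φ φst) ∧ IsCBFullK φ

/-- The cone `𝒮_k` of `T(H)`: the trace-norm closed convex cone generated by
the `ω_{x,x} = x ⊠ x` with `rank x ≤ k` (rank as an operator on `K`). -/
def SchmidtCone (m : HSModel e H) (k : ℕ) : Set (H →L[ℂ] H) :=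
  {T | ∀ ε : ℝ, 0 < ε → ∃ (n : ℕ) (x : Fin n → H),
    (∀ i, rankLE (m.toOp (x i)) k) ∧
      traceNorm (T - ∑ i, rankOne (x i) (x i)) < ε}

/-- `ψ` belongs to the convex cone `𝔼_k` generated by the maps `Ad_V` with
`rank V ≤ k`. -/
def InEk (k : ℕ) (ψ : (K →L[ℂ] K) →ₗ[ℂ] (K →L[ℂ] K)) : Prop :=
  ∃ (n : ℕ) (V : Fin n → (K →L[ℂ] K)), (∀ i, rankLE (V i) k) ∧
    ∀ x, ψ x = ∑ i, star (V i) * x * V i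

/-- `φ` (with Choi trace-class operator `Dphi = D_φ`) is `k`-superpositive:
it lies in the `‖·‖_D`-closure of the cone `𝔼_k`, where `‖ψ‖_D = ‖D_ψ‖_{T(H)}`. -/
def kSuper {ιH : Type*} (bH : HilbertBasis ιH ℂ H) (m : HSModel e H) (x0 : H)
    (k : ℕ) (Dphi : H →L[ℂ] H) : Prop :=
  ∀ ε : ℝ, 0 < ε → ∃ ψ Ψ Ψst, InEk k ψ ∧ HSExt m ψ Ψ ∧ IsNormalPair bH Ψ Ψst ∧
    traceNorm (Dphi - Ψst (rankOne x0 x0)) < ε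


/-! ### Amplification to `ℓ²(κ, H)` and density of irreducible *-algebras -/

section Density

variable {H : Type*} [NormedAddCommGroup H] {κ κ' : Type*}

/-- The Hilbert space `ℓ²(κ, H)`. -/
abbrev Ampl (κ H : Type*) [NormedAddCommGroup H] := lp (fun _ : κ => H) 2

lemma hasSum_norm_sq (f : Ampl κ H) : HasSum (fun k => ‖f k‖ ^ 2) (‖f‖ ^ 2) := by
  have h := lp.hasSum_norm (p := 2) (by norm_num) f
  simpa using h

lemma memℓp_two_of_summable {f : κ → H} (h : Summable fun k => ‖f k‖ ^ 2) :
    Memℓp (E := fun _ : κ => H) f 2 := by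
  rw [memℓp_gen_iff (by norm_num)]
  simpa using h

variable [InnerProductSpace ℂ H]

/-- The bounded operator between `ℓ²` spaces induced by a linear map on functions. -/
def amplMap (F : (κ → H) →ₗ[ℂ] (κ' → H)) (C : ℝ) (hC : 0 ≤ C)
    (hF : ∀ ξ : Ampl κ H, Summable (fun k => ‖F ξ k‖ ^ 2) ∧
      ∑' k, ‖F ξ k‖ ^ 2 ≤ (C * ‖ξ‖) ^ 2) : Ampl κ H →L[ℂ] Ampl κ' H :=
  LinearMap.mkContinuous
    { toFun := fun ξ => ⟨F ξ, memℓp_two_of_summable (hF ξ).1⟩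
      map_add' := fun ξ η => by
        ext k
        exact congrFun (F.map_add ξ η) k
      map_smul' := fun c ξ => by
        ext k
        exact congrFun (F.map_smul c ξ) k } C
    (fun ξ => by
      refine le_of_sq_le_sq ?_ (by positivity)
      rw [← (hasSum_norm_sq _).tsum_eq]
      exact (hF ξ).2)

/-- The restriction `ℓ²(κ, H) → ℓ²(κ', H)` along an injection `κ' → κ`. -/
def amplRestrict (j : κ' → κ) (hj : Function.Injective j) : Ampl κ H →L[ℂ] Ampl κ' H :=
  amplMap (LinearMap.funLeft ℂ H j) 1 zero_le_one fun ξ => by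
    have hs := (hasSum_norm_sq ξ).summable
    refine ⟨hs.comp_injective hj, ?_⟩
    rw [one_mul, ← (hasSum_norm_sq ξ).tsum_eq]
    exact tsum_comp_le_tsum_of_inj hs (fun _ => by positivity) hj

/-- The diagonal action of an operator on `ℓ²(κ, H)`. -/
def ampl (κ : Type*) (a : H →L[ℂ] H) : Ampl κ H →L[ℂ] Ampl κ H :=
  amplMap (LinearMap.compLeft (a : H →ₗ[ℂ] H) κ) ‖a‖ (norm_nonneg a) fun ξ => by
    have hs := (hasSum_norm_sq ξ).mul_left (‖a‖ ^ 2)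
    have hle : ∀ k, ‖LinearMap.compLeft (a : H →ₗ[ℂ] H) κ ξ k‖ ^ 2 ≤ ‖a‖ ^ 2 * ‖ξ k‖ ^ 2 := by
      intro k
      rw [← mul_pow]
      exact pow_le_pow_left₀ (norm_nonneg _) (a.le_opNorm _) 2
    have hsum := Summable.of_nonneg_of_le (fun k => by positivity) hle hs.summable
    refine ⟨hsum, ?_⟩
    rw [mul_pow, ← hs.tsum_eq]
    exact hsum.tsum_le_tsum hle hs.summable

lemma ampl_apply (a : H →L[ℂ] H) (ξ : Ampl κ H) (k : κ) : ampl κ a ξ k = a (ξ k) := rfl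

/-- The amplification as a linear map. -/
def amplL (κ : Type*) : (H →L[ℂ] H) →ₗ[ℂ] (Ampl κ H →L[ℂ] Ampl κ H) where
  toFun := ampl κ
  map_add' _ _ := rfl
  map_smul' _ _ := rfl

lemma ampl_single [DecidableEq κ] (a : H →L[ℂ] H) (k : κ) (h : H) :
    ampl κ a (lp.single 2 k h) = lp.single 2 k (a h) := by
  ext l
  rcases eq_or_ne l k with rfl | hl
  · simp [ampl_apply]
  · simp [ampl_apply, hl]

variable [CompleteSpace H]

lemma ampl_star (a : H →L[ℂ] H) : ampl κ (star a) = star (ampl κ a) := by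
  rw [star_eq_adjoint, star_eq_adjoint, eq_adjoint_iff]
  intro ξ η
  rw [lp.inner_eq_tsum, lp.inner_eq_tsum]
  exact tsum_congr fun k => by simp [ampl_apply, adjoint_inner_left]

/-- An orthogonal projection commutes with every operator `a` such that `a` and `star a` leave
its range invariant. -/
lemma starProjection_commute {E : Type*} [NormedAddCommGroup E] [InnerProductSpace ℂ E]
    [CompleteSpace E] (N : Submodule ℂ E) [N.HasOrthogonalProjection] (a : E →L[ℂ] E)
    (h : ∀ x ∈ N, a x ∈ N) (h' : ∀ x ∈ N, star a x ∈ N) (x : E) :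
    N.starProjection (a x) = a (N.starProjection x) := by
  refine Submodule.eq_starProjection_of_mem_of_inner_eq_zero
    (h _ (Submodule.starProjection_apply_mem _ _)) fun w hw => ?_
  rw [← map_sub, ← adjoint_inner_right]
  exact Submodule.starProjection_inner_eq_zero _ _ (h' w hw)

/-- The closure of a *-invariant orbit is mapped into itself. -/
lemma mapsTo_topologicalClosure {E : Type*} [NormedAddCommGroup E] [InnerProductSpace ℂ E]
    (N : Submodule ℂ E) (a : E →L[ℂ] E) (h : ∀ x ∈ N, a x ∈ N) :
    ∀ x ∈ N.topologicalClosure, a x ∈ N.topologicalClosure := fun _ hx =>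
  map_mem_closure a.continuous hx h

/-- Double commutant density: a unital *-algebra with trivial commutant is ultrastrongly dense. -/
theorem ampl_mem_closure (A : Submodule ℂ (H →L[ℂ] H)) (h1 : 1 ∈ A)
    (hmul : ∀ a ∈ A, ∀ c ∈ A, a * c ∈ A) (hstar : ∀ a ∈ A, star a ∈ A)
    (hcomm : ∀ T : H →L[ℂ] H, (∀ a ∈ A, T * a = a * T) → ∃ c : ℂ, T = c • 1)
    (ξ : Ampl κ H) (X : H →L[ℂ] H) :
    ampl κ X ξ ∈ closure {η | ∃ a ∈ A, ampl κ a ξ = η} := by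
  classical
  let N₀ : Submodule ℂ (Ampl κ H) :=
    A.map ((ContinuousLinearMap.apply ℂ (Ampl κ H) ξ).toLinearMap ∘ₗ amplL κ)
  have hN₀ : (N₀ : Set (Ampl κ H)) = {η | ∃ a ∈ A, ampl κ a ξ = η} := rfl
  have hinv₀ : ∀ a ∈ A, ∀ η ∈ N₀, ampl κ a η ∈ N₀ := by
    rintro a ha _ ⟨c, hc, rfl⟩
    exact ⟨a * c, hmul a ha c hc, rfl⟩
  let N := N₀.topologicalClosure
  have hξ : ξ ∈ N := subset_closure ⟨1, h1, rfl⟩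
  have : CompleteSpace N := N₀.isClosed_topologicalClosure.completeSpace_coe
  have hP : ∀ a ∈ A, ∀ η, N.starProjection (ampl κ a η) = ampl κ a (N.starProjection η) := by
    intro a ha
    refine starProjection_commute N _ (mapsTo_topologicalClosure _ _ (hinv₀ a ha)) ?_
    rw [← ampl_star]
    exact mapsTo_topologicalClosure _ _ (hinv₀ _ (hstar a ha))
  have hentry : ∀ k l : κ, ∃ c : ℂ, ∀ h : H, N.starProjection (lp.single 2 l h) k = c • h := by
    intro k l
    let T : H →L[ℂ] H := lp.evalCLM ℂ (fun _ : κ => H) 2 k ∘L N.starProjection ∘L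
      lp.singleContinuousLinearMap ℂ (fun _ : κ => H) 2 l
    obtain ⟨c, hc⟩ := hcomm T fun a ha => by
      ext h
      change N.starProjection (lp.single 2 l (a h)) k = a (N.starProjection (lp.single 2 l h) k)
      rw [← ampl_single, hP a ha, ampl_apply]
    exact ⟨c, fun h => congrArg (fun S : H →L[ℂ] H => S h) hc⟩
  have hX : N.starProjection ∘L ampl κ X = ampl κ X ∘L N.starProjection := by
    refine lp.ext_continuousLinearMap (by norm_num) fun l => ?_
    ext h k
    obtain ⟨c, hc⟩ := hentry k l
    change N.starProjection (ampl κ X (lp.single 2 l h)) k =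
      X (N.starProjection (lp.single 2 l h) k)
    rw [ampl_single, hc, hc, map_smul]
  have hXξ := congrArg (fun S : Ampl κ H →L[ℂ] Ampl κ H => S ξ) hX
  simp only [ContinuousLinearMap.comp_apply,
    Submodule.starProjection_eq_self_iff.mpr hξ] at hXξ
  rw [← hN₀]
  exact Submodule.starProjection_eq_self_iff.mp hXξ

end Density

/-! ### Trace class operators -/

section TraceClass

variable {H : Type*} [NormedAddCommGroup H] [InnerProductSpace ℂ H]

lemma rankOne_apply (x y z : H) : rankOne x y z = ⟪y, z⟫ • x := rfl

lemma pairing_rankOne_right {ι : Type*} (b : HilbertBasis ι ℂ H) (X : H →L[ℂ] H) (u v : H) :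
    pairing b X (rankOne u v) = ⟪v, X u⟫ := by
  rw [← (b.hasSum_inner_mul_inner v (X u)).tsum_eq]
  simp [pairing, tr, rankOne_apply]

lemma pairing_mul_left {ι : Type*} (b : HilbertBasis ι ℂ H) (X Z T : H →L[ℂ] H) :
    pairing b (X * Z) T = pairing b X (Z * T) := rfl

lemma isPositive_of_inner_nonneg {T : H →L[ℂ] H} (h : ∀ z, 0 ≤ ⟪z, T z⟫) : T.IsPositive := by
  rw [isPositive_iff_complex]
  intro z
  have hz : 0 ≤ ⟪T z, z⟫ := by
    rw [← inner_conj_symm, (Complex.conj_eq_iff_im).mpr (Complex.nonneg_iff.mp (h z)).2.symm]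
    exact h z
  obtain ⟨hre, him⟩ := Complex.nonneg_iff.mp hz
  exact ⟨Complex.ext (by simp) (by simpa using him), hre⟩

/-- `T = Σₙ xₙ ⊠ yₙ` with square summable families `x` and `y`. -/
structure NuclearRep (T : H →L[ℂ] H) (x y : ℕ → H) : Prop where
  left : Summable fun n => ‖x n‖ ^ 2
  right : Summable fun n => ‖y n‖ ^ 2
  apply_eq : ∀ z, T z = ∑' n, ⟪y n, z⟫ • x n

lemma exists_balanced (x y : H) : ∃ x' y' : H, ‖x'‖ ^ 2 = ‖x‖ * ‖y‖ ∧ ‖y'‖ ^ 2 = ‖x‖ * ‖y‖ ∧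
    ∀ z : H, ⟪y', z⟫ • x' = ⟪y, z⟫ • x := by
  rcases eq_or_ne x 0 with rfl | hx
  · exact ⟨0, 0, by simp⟩
  rcases eq_or_ne y 0 with rfl | hy
  · exact ⟨0, 0, by simp⟩
  have hx' : 0 < ‖x‖ := norm_pos_iff.mpr hx
  have hy' : 0 < ‖y‖ := norm_pos_iff.mpr hy
  set t : ℝ := Real.sqrt (‖y‖ / ‖x‖) with ht
  have htpos : 0 < t := Real.sqrt_pos.mpr (by positivity)
  have hsq : t ^ 2 = ‖y‖ / ‖x‖ := Real.sq_sqrt (by positivity)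
  refine ⟨(t : ℂ) • x, ((t⁻¹ : ℝ) : ℂ) • y, ?_, ?_, fun z => ?_⟩
  · rw [norm_smul, mul_pow, Complex.norm_real, Real.norm_of_nonneg htpos.le, hsq]
    field_simp
  · rw [norm_smul, mul_pow, Complex.norm_real, Real.norm_of_nonneg (inv_pos.mpr htpos).le,
      inv_pow, hsq]
    field_simp
  · have : (t : ℂ) ≠ 0 := by exact_mod_cast htpos.ne'
    rw [inner_smul_left, smul_smul, Complex.conj_ofReal]
    push_cast
    field_simp

lemma IsTraceClass.exists_nuclearRep {T : H →L[ℂ] H} (hT : IsTraceClass T) :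
    ∃ x y, NuclearRep T x y := by
  obtain ⟨x, y, hs, h⟩ := hT
  choose x' y' hx hy hxy using fun n => exists_balanced (x n) (y n)
  exact ⟨x', y', by simpa only [hx], by simpa only [hy], fun z => by simp only [hxy, h]⟩

lemma isTraceClass_rankOne (u v : H) : IsTraceClass (rankOne u v) := by
  refine ⟨Pi.single 0 u, Pi.single 0 v, ?_, fun z => ?_⟩
  · refine summable_of_ne_finset_zero (s := {0}) fun n hn => ?_
    simp [Pi.single_eq_of_ne (Finset.notMem_singleton.mp hn)]
  · rw [tsum_eq_single 0 fun n hn => by simp [Pi.single_eq_of_ne hn]]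
    simp [rankOne_apply]

namespace NuclearRep

variable {T : H →L[ℂ] H} {x y : ℕ → H}

lemma summable_mul (h : NuclearRep T x y) : Summable fun n => ‖x n‖ * ‖y n‖ := by
  refine Summable.of_nonneg_of_le (fun n => by positivity) (fun n => ?_) (h.left.add h.right)
  nlinarith [sq_nonneg (‖x n‖ - ‖y n‖), sq_nonneg (‖x n‖), sq_nonneg (‖y n‖)]

lemma isTraceClass (h : NuclearRep T x y) : IsTraceClass T := ⟨x, y, h.summable_mul, h.apply_eq⟩

variable [CompleteSpace H]

lemma hasSum_apply (h : NuclearRep T x y) (z : H) :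
    HasSum (fun n => ⟪y n, z⟫ • x n) (T z) := by
  rw [h.apply_eq]
  refine (Summable.of_norm_bounded (h.summable_mul.mul_left ‖z‖) fun n => ?_).hasSum
  rw [norm_smul]
  calc ‖⟪y n, z⟫‖ * ‖x n‖ ≤ ‖y n‖ * ‖z‖ * ‖x n‖ := by gcongr; exact norm_inner_le_norm _ _
    _ = ‖z‖ * (‖x n‖ * ‖y n‖) := by ring

lemma mul_left (h : NuclearRep T x y) (X : H →L[ℂ] H) :
    NuclearRep (X * T) (fun n => X (x n)) y where
  left := by
    refine Summable.of_nonneg_of_le (fun n => by positivity) (fun n => ?_)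
      (h.left.mul_left (‖X‖ ^ 2))
    rw [← mul_pow]
    exact pow_le_pow_left₀ (norm_nonneg _) (X.le_opNorm _) 2
  right := h.right
  apply_eq z := by
    have := (h.hasSum_apply z).mapL X
    simpa using this.tsum_eq.symm

lemma mul_right (h : NuclearRep T x y) (Y : H →L[ℂ] H) :
    NuclearRep (T * Y) x (fun n => star Y (y n)) where
  left := h.left
  right := by
    refine Summable.of_nonneg_of_le (fun n => by positivity) (fun n => ?_)
      (h.right.mul_left (‖star Y‖ ^ 2))
    rw [← mul_pow]
    exact pow_le_pow_left₀ (norm_nonneg _) ((star Y).le_opNorm _) 2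
  apply_eq z := by
    simp only [star_eq_adjoint, adjoint_inner_left]
    exact h.apply_eq (Y z)

/-- `Tr (X T) = Σₙ (X xₙ | yₙ)`. -/
lemma hasSum_pairing (h : NuclearRep T x y) {ι : Type*} (b : HilbertBasis ι ℂ H)
    (X : H →L[ℂ] H) : HasSum (fun n => ⟪y n, X (x n)⟫) (pairing b X T) := by
  have key : ∀ {T : H →L[ℂ] H} {x : ℕ → H}, NuclearRep T x y →
      HasSum (fun n => ⟪y n, x n⟫) (tr b T) := by
    intro T x h
    have hparseval : ∀ u : H, HasSum (fun i => ‖⟪b i, u⟫‖ ^ 2) (‖u‖ ^ 2) := fun u => by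
      have := hasSum_norm_sq (b.repr u)
      simpa [b.repr_apply_apply] using this
    let F : ℕ × ι → ℂ := fun p => ⟪y p.1, b p.2⟫ * ⟪b p.2, x p.1⟫
    have hF : Summable F := by
      let B : ℕ × ι → ℝ := fun p => ‖⟪b p.2, y p.1⟫‖ ^ 2 + ‖⟪b p.2, x p.1⟫‖ ^ 2
      have hB : Summable B := by
        refine (summable_prod_of_nonneg fun p => by positivity).mpr ⟨fun n =>
          ((hparseval (y n)).add (hparseval (x n))).summable, ?_⟩
        simp only [B, ((hparseval _).add (hparseval _)).tsum_eq]
        exact h.right.add h.left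
      refine Summable.of_norm_bounded hB fun p => ?_
      have hcomm : ‖⟪y p.1, b p.2⟫‖ = ‖⟪b p.2, y p.1⟫‖ := norm_inner_symm _ _
      simp only [F, B, norm_mul, hcomm]
      nlinarith [sq_nonneg (‖⟪b p.2, y p.1⟫‖ - ‖⟪b p.2, x p.1⟫‖),
        sq_nonneg (‖⟪b p.2, y p.1⟫‖), sq_nonneg (‖⟪b p.2, x p.1⟫‖)]
    have h₁ : HasSum (fun n => ⟪y n, x n⟫) (∑' p, F p) :=
      hF.hasSum.prod_fiberwise fun n => b.hasSum_inner_mul_inner (y n) (x n)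
    have h₂ : HasSum (fun i => ⟪b i, T (b i)⟫) (∑' p, F p) := by
      have hF' := (Equiv.prodComm ι ℕ).hasSum_iff.mpr hF.hasSum
      refine hF'.prod_fiberwise fun i => ?_
      have := (h.hasSum_apply (b i)).mapL (innerSL ℂ (b i))
      simpa [F, inner_smul_right] using this
    rw [tr, h₂.tsum_eq]
    exact h₁
  exact key (h.mul_left X)

end NuclearRep

variable [CompleteSpace H]

lemma IsTraceClass.mul_left {T : H →L[ℂ] H} (hT : IsTraceClass T) (X : H →L[ℂ] H) :
    IsTraceClass (X * T) := by
  obtain ⟨x, y, h⟩ := hT.exists_nuclearRep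
  exact (h.mul_left X).isTraceClass

lemma IsTraceClass.mul_right {T : H →L[ℂ] H} (hT : IsTraceClass T) (X : H →L[ℂ] H) :
    IsTraceClass (T * X) := by
  obtain ⟨x, y, h⟩ := hT.exists_nuclearRep
  exact (h.mul_right X).isTraceClass

lemma mul_rankOne_mul_star (a : H →L[ℂ] H) (u v : H) :
    a * rankOne u v * star a = rankOne (a u) (a v) := by
  ext z
  simp [rankOne_apply, star_eq_adjoint, adjoint_inner_right]

lemma star_rankOne_mul_self {u : H} (hu : ‖u‖ = 1) (z : H) :
    star (rankOne u z) * rankOne u z = rankOne z z := by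
  refine ContinuousLinearMap.ext fun w => ext_inner_left ℂ fun v => ?_
  simp [rankOne_apply, star_eq_adjoint, adjoint_inner_right, inner_smul_right, inner_smul_left,
    hu]

variable {ι : Type*} (b : HilbertBasis ι ℂ H)

/-- Cyclicity of the trace. -/
lemma pairing_mul_right {T : H →L[ℂ] H} (hT : IsTraceClass T) (X Z : H →L[ℂ] H) :
    pairing b (Z * X) T = pairing b X (T * Z) := by
  obtain ⟨x, y, h⟩ := hT.exists_nuclearRep
  refine (h.hasSum_pairing b (Z * X)).unique ?_
  simpa [star_eq_adjoint, adjoint_inner_left] using (h.mul_right Z).hasSum_pairing b X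

lemma pairing_rankOne_left (T : H →L[ℂ] H) (u v : H) :
    pairing b (rankOne u v) T = ⟪v, T u⟫ := by
  have h : rankOne u v * T = 1 * rankOne u (star T v) := by
    ext z
    simp [rankOne_apply, star_eq_adjoint, adjoint_inner_left]
  calc pairing b (rankOne u v) T = pairing b 1 (rankOne u (star T v)) := congrArg (tr b) h
    _ = ⟪v, T u⟫ := by
      rw [pairing_rankOne_right, star_eq_adjoint, adjoint_inner_left]
      rfl

lemma pairing_nonneg {X T : H →L[ℂ] H} (hX : X.IsPositive) (hT : T.IsPositive)
    (hTc : IsTraceClass T) : 0 ≤ pairing b X T := by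
  obtain ⟨Y, rfl⟩ := CStarAlgebra.nonneg_iff_eq_star_mul_self.mp ((nonneg_iff_isPositive X).mpr hX)
  rw [pairing_mul_right b hTc]
  refine tsum_nonneg fun i => ?_
  have h := hT.inner_nonneg_right (star Y (b i))
  rwa [star_eq_adjoint, adjoint_inner_left] at h

end TraceClass

/-! ### Factors with a cyclic and separating vector -/

section Factor

variable {H : Type*} [NormedAddCommGroup H] [InnerProductSpace ℂ H] [CompleteSpace H]

/-- The linear span of the products `A'B` with `A' ∈ M'` and `B ∈ M`, i.e. `alg(M', M)`. -/
def mixedSpan (M : VonNeumannAlgebra H) : Submodule ℂ (H →L[ℂ] H) :=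
  Submodule.span ℂ {T | ∃ A' ∈ M.commutant, ∃ B ∈ M, A' * B = T}

lemma commutant_comm {M : VonNeumannAlgebra H} {A' B : H →L[ℂ] H} (hA' : A' ∈ M.commutant)
    (hB : B ∈ M) : A' * B = B * A' :=
  (VonNeumannAlgebra.mem_commutant_iff.mp hA' B hB).symm

lemma exists_eq_sum_of_mem_mixedSpan {M : VonNeumannAlgebra H} {a : H →L[ℂ] H}
    (ha : a ∈ mixedSpan M) : ∃ (k : ℕ) (A' B : Fin k → H →L[ℂ] H),
      (∀ i, A' i ∈ M.commutant) ∧ (∀ i, B i ∈ M) ∧ a = ∑ i, A' i * B i := by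
  obtain ⟨k, c, g, rfl⟩ := Submodule.mem_span_set'.mp ha
  choose A' hA' B hB h using fun i => (g i).2
  refine ⟨k, fun i => c i • A' i, B, fun i => ?_, hB, ?_⟩
  · exact M.commutant.toStarSubalgebra.smul_mem (hA' i) (c i)
  · exact Finset.sum_congr rfl fun i _ => by rw [← h i, smul_mul_assoc]

lemma mixedSpan_mul_mem {M : VonNeumannAlgebra H} {a c : H →L[ℂ] H} (ha : a ∈ mixedSpan M)
    (hc : c ∈ mixedSpan M) : a * c ∈ mixedSpan M := by
  have h := Submodule.mul_mem_mul ha hc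
  rw [mixedSpan, Submodule.span_mul_span] at h
  refine Submodule.span_mono ?_ h
  rintro _ ⟨_, ⟨A', hA', B, hB, rfl⟩, _, ⟨C', hC', D, hD, rfl⟩, rfl⟩
  refine ⟨A' * C', mul_mem hA' hC', B * D, mul_mem hB hD, ?_⟩
  change A' * C' * (B * D) = A' * B * (C' * D)
  rw [mul_assoc, mul_assoc, ← mul_assoc C', commutant_comm hC' hB, mul_assoc B]

lemma mixedSpan_star_mem {M : VonNeumannAlgebra H} {a : H →L[ℂ] H} (ha : a ∈ mixedSpan M) :
    star a ∈ mixedSpan M := by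
  induction ha using Submodule.span_induction with
  | mem _ h =>
    obtain ⟨A', hA', B, hB, rfl⟩ := h
    refine Submodule.subset_span ⟨star A', star_mem hA', star B, star_mem hB, ?_⟩
    rw [star_mul, commutant_comm (star_mem hA') (star_mem hB)]
  | zero => simp
  | add _ _ _ _ hx hy => simpa using add_mem hx hy
  | smul c _ _ hx => simpa using Submodule.smul_mem _ (star c) hx

lemma one_mem_mixedSpan (M : VonNeumannAlgebra H) : 1 ∈ mixedSpan M :=
  Submodule.subset_span ⟨1, one_mem _, 1, one_mem _, one_mul 1⟩

/-- For a factor `M`, the algebra `alg(M', M)` is ultrastrongly dense in `B(H)`. -/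
theorem IsFactor.ampl_mem_closure {M : VonNeumannAlgebra H} (hM : IsFactor M) {κ : Type*}
    (ξ : Ampl κ H) (X : H →L[ℂ] H) :
    ampl κ X ξ ∈ closure {η | ∃ a ∈ mixedSpan M, ampl κ a ξ = η} := by
  refine ChoiInf.ampl_mem_closure (mixedSpan M) (one_mem_mixedSpan M)
    (fun a ha c hc => mixedSpan_mul_mem ha hc) (fun a ha => mixedSpan_star_mem ha)
    (fun T hT => hM T ?_ ?_) ξ X
  · rw [← VonNeumannAlgebra.commutant_commutant M, VonNeumannAlgebra.mem_commutant_iff]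
    intro A' hA'
    exact (hT A' (Submodule.subset_span ⟨A', hA', 1, one_mem _, mul_one A'⟩)).symm
  · rw [VonNeumannAlgebra.mem_commutant_iff]
    intro B hB
    exact (hT B (Submodule.subset_span ⟨1, one_mem _, B, hB, one_mul B⟩)).symm

/-- A separating vector for `M` is cyclic for the commutant of `M`. -/
theorem Separating.cyclic_commutant {M : VonNeumannAlgebra H} {x0 : H} (h : Separating M x0) :
    Cyclic M.commutant x0 := by
  let N₀ : Submodule ℂ H := M.commutant.toSubalgebra.toSubmodule.map
    (ContinuousLinearMap.apply ℂ H x0).toLinearMap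
  have hN₀ : (N₀ : Set H) = {y | ∃ A ∈ M.commutant, A x0 = y} := rfl
  let N := N₀.topologicalClosure
  have : CompleteSpace N := N₀.isClosed_topologicalClosure.completeSpace_coe
  have hinv : ∀ a ∈ M.commutant, ∀ y ∈ N, a y ∈ N := by
    intro a ha
    refine mapsTo_topologicalClosure _ a ?_
    rintro _ ⟨c, hc, rfl⟩
    exact ⟨a * c, mul_mem (S := VonNeumannAlgebra H) ha hc, rfl⟩
  have hP : N.starProjection ∈ M := by
    rw [← VonNeumannAlgebra.commutant_commutant M, VonNeumannAlgebra.mem_commutant_iff]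
    intro a ha
    ext z
    exact (starProjection_commute N a (hinv a ha) (hinv _ (star_mem ha)) z).symm
  have hx0 : x0 ∈ N := subset_closure ⟨1, one_mem M.commutant, rfl⟩
  have hone : 1 - N.starProjection = 0 := h _ (sub_mem (one_mem M) hP) <| by
    simp [Submodule.starProjection_eq_self_iff.mpr hx0]
  intro z
  rw [← hN₀]
  have hz : N.starProjection z = z := by rw [← sub_eq_zero.mp hone]; rfl
  exact Submodule.starProjection_eq_self_iff.mp hz

variable {ι : Type*} (b : HilbertBasis ι ℂ H)

/-- Trace class operators are determined by their pairings with `alg(M', M)`. -/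
theorem IsFactor.pairing_eq_of_mixedSpan {M : VonNeumannAlgebra H} (hM : IsFactor M)
    {T₁ T₂ : H →L[ℂ] H} (h₁ : IsTraceClass T₁) (h₂ : IsTraceClass T₂)
    (h : ∀ a ∈ mixedSpan M, pairing b a T₁ = pairing b a T₂) (X : H →L[ℂ] H) :
    pairing b X T₁ = pairing b X T₂ := by
  obtain ⟨x₁, y₁, r₁⟩ := h₁.exists_nuclearRep
  obtain ⟨x₂, y₂, r₂⟩ := h₂.exists_nuclearRep
  let ξ : Ampl (ℕ ⊕ ℕ) H := ⟨Sum.elim x₁ x₂, memℓp_two_of_summable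
    (Summable.sum _ r₁.left r₂.left)⟩
  let υ₁ : Ampl ℕ H := ⟨y₁, memℓp_two_of_summable r₁.right⟩
  let υ₂ : Ampl ℕ H := ⟨y₂, memℓp_two_of_summable r₂.right⟩
  let R₁ := amplRestrict (H := H) (Sum.inl : ℕ → ℕ ⊕ ℕ) Sum.inl_injective
  let R₂ := amplRestrict (H := H) (Sum.inr : ℕ → ℕ ⊕ ℕ) Sum.inr_injective
  have hR₁ : ∀ a : H →L[ℂ] H, ⟪υ₁, R₁ (ampl _ a ξ)⟫ = pairing b a T₁ := fun a =>
    (lp.inner_eq_tsum _ _).trans (r₁.hasSum_pairing b a).tsum_eq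
  have hR₂ : ∀ a : H →L[ℂ] H, ⟪υ₂, R₂ (ampl _ a ξ)⟫ = pairing b a T₂ := fun a =>
    (lp.inner_eq_tsum _ _).trans (r₂.hasSum_pairing b a).tsum_eq
  have hclosed : IsClosed {η | ⟪υ₁, R₁ η⟫ = ⟪υ₂, R₂ η⟫} :=
    isClosed_eq (by fun_prop) (by fun_prop)
  have := hclosed.closure_subset_iff.mpr
    (by rintro _ ⟨a, ha, rfl⟩; exact (hR₁ a).trans ((h a ha).trans (hR₂ a).symm))
    (hM.ampl_mem_closure ξ X)
  exact (hR₁ X).symm.trans (Eq.trans this (hR₂ X))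

/-- Positivity of a trace class operator can be tested on squares in `alg(M', M)`. -/
theorem IsFactor.isPositive_of_mixedSpan {M : VonNeumannAlgebra H} (hM : IsFactor M)
    {T : H →L[ℂ] H} (hT : IsTraceClass T)
    (h : ∀ a ∈ mixedSpan M, 0 ≤ pairing b (star a * a) T) : T.IsPositive := by
  obtain ⟨x, y, r⟩ := hT.exists_nuclearRep
  let ξ : Ampl (ℕ ⊕ ℕ) H := ⟨Sum.elim x y, memℓp_two_of_summable
    (Summable.sum _ r.left r.right)⟩
  let R₁ := amplRestrict (H := H) (Sum.inl : ℕ → ℕ ⊕ ℕ) Sum.inl_injective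
  let R₂ := amplRestrict (H := H) (Sum.inr : ℕ → ℕ ⊕ ℕ) Sum.inr_injective
  have hR : ∀ a : H →L[ℂ] H,
      ⟪R₂ (ampl _ a ξ), R₁ (ampl _ a ξ)⟫ = pairing b (star a * a) T := fun a => by
    rw [lp.inner_eq_tsum, ← (r.hasSum_pairing b (star a * a)).tsum_eq]
    refine tsum_congr fun n => ?_
    change ⟪a (y n), a (x n)⟫ = ⟪y n, star a (a (x n))⟫
    rw [star_eq_adjoint, adjoint_inner_right]
  have hclosed : IsClosed {η | 0 ≤ ⟪R₂ η, R₁ η⟫} :=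
    isClosed_le (by fun_prop) (by fun_prop)
  have key : ∀ X : H →L[ℂ] H, 0 ≤ pairing b (star X * X) T := fun X => by
    rw [← hR]
    exact hclosed.closure_subset_iff.mpr
      (by rintro _ ⟨a, ha, rfl⟩; exact (h a ha).trans_eq (hR a).symm)
      (hM.ampl_mem_closure ξ X)
  refine isPositive_of_inner_nonneg fun z => ?_
  rcases eq_or_ne z 0 with rfl | hz
  · simp
  · obtain ⟨u, hu⟩ : ∃ u : H, ‖u‖ = 1 := ⟨_, norm_smul_inv_norm (𝕜 := ℂ) hz⟩
    have hz' := key (rankOne u z)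
    rwa [star_rankOne_mul_self hu, pairing_rankOne_left] at hz'

end Factor

/-! ### Choi operators of maps in `CB^σ_ε(M)` -/

section Choi

variable {H : Type*} [NormedAddCommGroup H] [InnerProductSpace ℂ H]
  {ι : Type*} {b : HilbertBasis ι ℂ H} {φ Φ Φst ψ Ψ Ψst θ Θ Θst : (H →L[ℂ] H) →ₗ[ℂ] (H →L[ℂ] H)}

lemma IsNormalPair.comp (hφ : IsNormalPair b Φ Φst) (hψ : IsNormalPair b Ψ Ψst) :
    IsNormalPair b (Φ ∘ₗ Ψ) (Ψst ∘ₗ Φst) :=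
  ⟨fun T hT => hψ.1 _ (hφ.1 T hT), fun A T hT =>
    (hφ.2 (Ψ A) T hT).trans (hψ.2 A _ (hφ.1 T hT))⟩

/-- `⟨X, D_θ⟩ = (θ̃(X) x₀ | x₀)`. -/
lemma IsNormalPair.pairing_choi (h : IsNormalPair b Θ Θst) (X : H →L[ℂ] H) (x0 : H) :
    pairing b X (Θst (rankOne x0 x0)) = ⟪x0, Θ X x0⟫ := by
  rw [← h.2 X _ (isTraceClass_rankOne x0 x0), pairing_rankOne_right]

variable [CompleteSpace H] {M : VonNeumannAlgebra H} {x0 : H}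

lemma ExtendsTilde.comp (hφ : ExtendsTilde M φ Φ) (hψ : ExtendsTilde M ψ Ψ)
    (hmem : ∀ B ∈ M, ψ B ∈ M) : ExtendsTilde M (φ ∘ₗ ψ) (Φ ∘ₗ Ψ) := fun A' hA' B hB => by
  simp [hψ A' hA' B hB, hφ A' hA' _ (hmem B hB)]

lemma extendsTilde_adL {V : H →L[ℂ] H} (hV : V ∈ M) : ExtendsTilde M (AdL V) (AdL V) :=
  fun A' hA' B _ => by
    change star V * (A' * B) * V = A' * (star V * B * V)
    simp only [← mul_assoc, commutant_comm hA' (star_mem hV)]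

lemma isNormalPair_adL (V : H →L[ℂ] H) : IsNormalPair b (AdL V) (AdL (star V)) := by
  have h : ∀ T, AdL (star V) T = V * T * star V := fun T => by
    change star (star V) * T * star V = _
    rw [star_star]
  refine ⟨fun T hT => h T ▸ (hT.mul_left V).mul_right _, fun A T hT => ?_⟩
  change pairing b (star V * A * V) T = _
  rw [h, pairing_mul_left, pairing_mul_right b (hT.mul_left V)]

lemma ExtendsTilde.pairing_choi_sum (hθ : ExtendsTilde M θ Θ) (hn : IsNormalPair b Θ Θst)
    (hmem : ∀ B ∈ M, θ B ∈ M) {k : ℕ} {A' : Fin k → H →L[ℂ] H}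
    (hA' : ∀ i, A' i ∈ M.commutant) {A : Fin k → Fin k → H →L[ℂ] H} (hA : ∀ i j, A i j ∈ M)
    (x0 : H) :
    pairing b (∑ i, ∑ j, star (A' i) * A i j * A' j) (Θst (rankOne x0 x0)) =
      ∑ i, ∑ j, ⟪A' i x0, θ (A i j) (A' j x0)⟫ := by
  rw [hn.pairing_choi]
  simp only [map_sum, _root_.sum_apply, inner_sum]
  refine Finset.sum_congr rfl fun i _ => Finset.sum_congr rfl fun j _ => ?_
  rw [mul_assoc, ← commutant_comm (hA' j) (hA i j), ← mul_assoc,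
    hθ _ (mul_mem (star_mem (hA' i)) (hA' j)) _ (hA i j), mul_assoc,
    commutant_comm (hA' j) (hmem _ (hA i j)), star_eq_adjoint]
  simp only [mul_apply_eq_comp, adjoint_inner_right]

theorem ExtendsTilde.isCPOn_of_isPositive (hθ : ExtendsTilde M θ Θ) (hn : IsNormalPair b Θ Θst)
    (hmem : ∀ B ∈ M, θ B ∈ M) (hcyc : Cyclic M.commutant x0)
    (hpos : (Θst (rankOne x0 x0)).IsPositive) : IsCPOn M θ := by
  intro k A hA hApos v
  have hclosed : IsClosed {v : Fin k → H | 0 ≤ ∑ i, ∑ j, ⟪v i, θ (A i j) (v j)⟫} :=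
    isClosed_le (by fun_prop) (by fun_prop)
  refine hclosed.closure_subset_iff.mpr ?_ (dense_pi Set.univ (fun _ _ => hcyc) v)
  intro w hw
  choose A' hA' hw using fun i => hw i (Set.mem_univ i)
  change 0 ≤ ∑ i, ∑ j, ⟪w i, θ (A i j) (w j)⟫
  simp only [← hw]
  rw [← hθ.pairing_choi_sum hn hmem hA' hA x0]
  refine pairing_nonneg b (isPositive_of_inner_nonneg fun z => ?_) hpos
    (hn.1 _ (isTraceClass_rankOne x0 x0))
  simpa [_root_.sum_apply, inner_sum, star_eq_adjoint, adjoint_inner_right] using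
    hApos fun i => A' i z

lemma matPos_star_mul {k : ℕ} (B : Fin k → H →L[ℂ] H) : MatPos fun i j => star (B i) * B j := by
  intro v
  have h : ∑ i, ∑ j, ⟪v i, (star (B i) * B j) (v j)⟫ = ⟪∑ i, B i (v i), ∑ j, B j (v j)⟫ := by
    simp only [sum_inner, inner_sum, star_eq_adjoint, mul_apply_eq_comp, adjoint_inner_right]
    exact Finset.sum_comm
  rw [h]
  exact isPositive_one.inner_nonneg_right _

theorem ExtendsTilde.isPositive_of_isCPOn (hM : IsFactor M) (hθ : ExtendsTilde M θ Θ)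
    (hn : IsNormalPair b Θ Θst) (hmem : ∀ B ∈ M, θ B ∈ M) (hcp : IsCPOn M θ) (x0 : H) :
    (Θst (rankOne x0 x0)).IsPositive := by
  refine hM.isPositive_of_mixedSpan b (hn.1 _ (isTraceClass_rankOne x0 x0)) fun a ha => ?_
  obtain ⟨k, A', B, hA', hB, rfl⟩ := exists_eq_sum_of_mem_mixedSpan ha
  have hAB : ∀ i j, star (B i) * B j ∈ M := fun i j => mul_mem (star_mem (hB i)) (hB j)
  have h : star (∑ i, A' i * B i) * ∑ i, A' i * B i =
      ∑ i, ∑ j, star (A' i) * (star (B i) * B j) * A' j := by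
    rw [star_sum, Finset.sum_mul_sum]
    refine Finset.sum_congr rfl fun i _ => Finset.sum_congr rfl fun j _ => ?_
    rw [star_mul, ← commutant_comm (star_mem (hA' i)) (star_mem (hB i)),
      commutant_comm (hA' j) (hB j)]
    simp only [mul_assoc]
  rw [h, hθ.pairing_choi_sum hn hmem hA' hAB x0]
  exact hcp k _ hAB (matPos_star_mul B) _

/-- The predual map is a bimodule map over `M'`. -/
lemma ExtendsTilde.pairing_predual_conj (hM : IsFactor M) (hθ : ExtendsTilde M θ Θ)
    (hn : IsNormalPair b Θ Θst) (hmem : ∀ B ∈ M, θ B ∈ M) {A' : H →L[ℂ] H}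
    (hA' : A' ∈ M.commutant) {T : H →L[ℂ] H} (hT : IsTraceClass T) (X : H →L[ℂ] H) :
    pairing b X (Θst (A' * T * star A')) = pairing b X (A' * Θst T * star A') := by
  have hT' := (hT.mul_left A').mul_right (star A')
  have hΘ := (hn.1 T hT).mul_left A'
  refine hM.pairing_eq_of_mixedSpan b (hn.1 _ hT') (hΘ.mul_right _) (fun a ha => ?_) X
  have hbimod : Θ (star A' * a * A') = star A' * Θ a * A' := by
    obtain ⟨k, C', B, hC', hB, rfl⟩ := exists_eq_sum_of_mem_mixedSpan ha
    simp only [Finset.mul_sum, Finset.sum_mul, map_sum]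
    refine Finset.sum_congr rfl fun i _ => ?_
    rw [← mul_assoc, mul_assoc _ (B i), ← commutant_comm hA' (hB i), ← mul_assoc,
      hθ _ (mul_mem (mul_mem (star_mem hA') (hC' i)) hA') _ (hB i), hθ _ (hC' i) _ (hB i),
      mul_assoc _ A', commutant_comm hA' (hmem _ (hB i))]
    simp only [mul_assoc]
  rw [← hn.2 a _ hT', ← pairing_mul_right b (hT.mul_left A'), ← pairing_mul_left, ← hbimod,
    hn.2 _ T hT, ← pairing_mul_right b hΘ, ← pairing_mul_left]

theorem ExtendsTilde.isPositive_choi (hM : IsFactor M) (hθ : ExtendsTilde M θ Θ)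
    (hn : IsNormalPair b Θ Θst) (hmem : ∀ B ∈ M, θ B ∈ M) (hcyc : Cyclic M.commutant x0)
    (hpos : (Θst (rankOne x0 x0)).IsPositive) : (Θ (rankOne x0 x0)).IsPositive := by
  refine isPositive_of_inner_nonneg fun z => ?_
  have hclosed : IsClosed {z | 0 ≤ ⟪z, Θ (rankOne x0 x0) z⟫} :=
    isClosed_le (by fun_prop) (by fun_prop)
  refine hclosed.closure_subset_iff.mpr ?_ (hcyc z)
  rintro _ ⟨A', hA', rfl⟩
  have hE := isTraceClass_rankOne x0 x0
  have h := hθ.pairing_predual_conj hM hn hmem hA' hE (rankOne x0 x0)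
  rw [mul_rankOne_mul_star, ← hn.2 _ _ (isTraceClass_rankOne _ _), pairing_rankOne_right,
    pairing_rankOne_left] at h
  change 0 ≤ ⟪A' x0, Θ (rankOne x0 x0) (A' x0)⟫
  rw [h]
  have h' := hpos.inner_nonneg_right (star A' x0)
  rwa [star_eq_adjoint, adjoint_inner_left] at h'

end Choi

/-- Theorem 3.4.  Let `S` be a convex cone in `CB^σ_ε(M)`
with `ψ ∘ Ad_V ∈ S` for every `V ∈ M`, `ψ ∈ S`.  For `φ ∈ CB^σ_ε(M)` (with
normal extension `Φ` and predual map `Φst`), the following are equivalent: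
(i) `⟨C_ψ, D_φ⟩ ≥ 0` for every `ψ ∈ S`; (ii) `φ ∘ ψ` is completely positive
for every `ψ ∈ S`; (iii) `φ̃(C_ψ) ≥ 0` for every `ψ ∈ S`;
(iv) `ψ̃_*(D_φ) ≥ 0` for every `ψ ∈ S`. -/
theorem statement6
    {H : Type*} [NormedAddCommGroup H] [InnerProductSpace ℂ H] [CompleteSpace H]
    [TopologicalSpace.SeparableSpace H]
    {ι : Type*} (b : HilbertBasis ι ℂ H)
    (M : VonNeumannAlgebra H) (hfactor : IsFactor M)
    (x0 : H) (hx0 : ‖x0‖ = 1) (hcyc : Cyclic M x0) (hsep : Separating M x0)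
    (S : Set ((H →L[ℂ] H) →ₗ[ℂ] (H →L[ℂ] H)))
    (hSsub : S ⊆ CBSigmaE b M)
    (hSadd : ∀ ψ₁ ∈ S, ∀ ψ₂ ∈ S, ψ₁ + ψ₂ ∈ S)
    (hSsmul : ∀ ψ ∈ S, ∀ c : ℝ, 0 ≤ c → (c : ℂ) • ψ ∈ S)
    (hSad : ∀ ψ ∈ S, ∀ V ∈ M, ψ ∘ₗ AdL V ∈ S)
    (φ Φ Φst : (H →L[ℂ] H) →ₗ[ℂ] (H →L[ℂ] H)) (hmem : ∀ B ∈ M, φ B ∈ M)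
    (hext : ExtendsTilde M φ Φ) (hnp : IsNormalPair b Φ Φst) :
    List.TFAE [
      ∀ ψ ∈ S, ∀ Ψ Ψst : (H →L[ℂ] H) →ₗ[ℂ] (H →L[ℂ] H),
        ExtendsTilde M ψ Ψ → IsNormalPair b Ψ Ψst →
        0 ≤ pairing b (Ψ (rankOne x0 x0)) (Φst (rankOne x0 x0)),
      ∀ ψ ∈ S, IsCPOn M (φ ∘ₗ ψ),
      ∀ ψ ∈ S, ∀ Ψ Ψst : (H →L[ℂ] H) →ₗ[ℂ] (H →L[ℂ] H),
        ExtendsTilde M ψ Ψ → IsNormalPair b Ψ Ψst →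
        (Φ (Ψ (rankOne x0 x0))).IsPositive,
      ∀ ψ ∈ S, ∀ Ψ Ψst : (H →L[ℂ] H) →ₗ[ℂ] (H →L[ℂ] H),
        ExtendsTilde M ψ Ψ → IsNormalPair b Ψ Ψst →
        (Ψst (Φst (rankOne x0 x0))).IsPositive] := by
  have hθ : ∀ ψ ∈ S, ∀ B ∈ M, (φ ∘ₗ ψ) B ∈ M := fun ψ hψ B hB => hmem _ ((hSsub hψ).1 B hB)
  have hcyc' := hsep.cyclic_commutant
  tfae_have 1 → 4 := by
    intro h ψ hψ Ψ Ψst hΨ hn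
    have hn' := hnp.comp hn
    refine isPositive_of_inner_nonneg fun z => ?_
    have hclosed : IsClosed {z | 0 ≤ ⟪z, Ψst (Φst (rankOne x0 x0)) z⟫} :=
      isClosed_le (by fun_prop) (by fun_prop)
    refine hclosed.closure_subset_iff.mpr ?_ (hcyc z)
    rintro _ ⟨V, hV, rfl⟩
    have hext' := hΨ.comp (extendsTilde_adL (star_mem hV)) fun B hB =>
      mul_mem (mul_mem (star_mem (star_mem hV)) hB) (star_mem hV)
    have h' := h _ (hSad ψ hψ _ (star_mem hV)) _ _ hext' (hn.comp (isNormalPair_adL (star V)))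
    have hE : AdL (star V) (rankOne x0 x0) = rankOne (V x0) (V x0) := by
      rw [← mul_rankOne_mul_star]
      change star (star V) * _ * _ = _
      rw [star_star]
    rwa [LinearMap.comp_apply, hE, hn.2 _ _ (hnp.1 _ (isTraceClass_rankOne x0 x0)),
      pairing_rankOne_left] at h'
  tfae_have 4 → 2 := by
    intro h ψ hψ
    obtain ⟨hψM, Ψ, Ψst, hΨ, hn⟩ := hSsub hψ
    exact (hext.comp hΨ hψM).isCPOn_of_isPositive (hnp.comp hn) (hθ ψ hψ) hcyc'
      (h ψ hψ Ψ Ψst hΨ hn)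
  tfae_have 2 → 3 := by
    intro h ψ hψ Ψ Ψst hΨ hn
    have hΘ := hext.comp hΨ (hSsub hψ).1
    exact hΘ.isPositive_choi hfactor (hnp.comp hn) (hθ ψ hψ) hcyc'
      (hΘ.isPositive_of_isCPOn hfactor (hnp.comp hn) (hθ ψ hψ) (h ψ hψ) x0)
  tfae_have 3 → 1 := by
    intro h ψ hψ Ψ Ψst hΨ hn
    rw [hnp.pairing_choi]
    exact (h ψ hψ Ψ Ψst hΨ hn).inner_nonneg_right x0
  tfae_finish

end ChoiInf
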